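/- arXiv:2007.09940 — 3 statements merged into one kernel-verified Lean document; each statement's English description precedes it below -/
import Mathlib

section
/- Let k ≥ 0 and γ ∈ E'_k. (i) If γ ≥ f_{2k+3} − 2, then for every integer r with 0 ≤ r ≤ f_{2k} − 1, H_{γ−f_{2k+3}+2+r, f_{2k+2}−1−r} = (−1)^{rk} (−1)^{r(r−1)/2} H_{γ−f_{2k+3}+2, f_{2k+2}−1}. (ii) If γ ≥ f_{2k+2} − 1, then for every integer r with 0 ≤ r ≤ f_{2k} − 1, H_{γ−f_{2k+2}+1+r, f_{2k+2}−1−r} = (−1)^{rk} (−1)^{r(r−1)/2} H_{γ−f_{2k+2}+1, f_{2k+2}−1}. (iii) If γ ≥ f_{2k+3} − 2, then for every integer r with 0 ≤ r ≤ f_{2k} − 1, H_{γ−f_{2k+3}+2+r, f_{2k+2}−1} = H_{γ−f_{2k+3}+2, f_{2k+2}−1}. -/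
/-- The substitution τ: 1 → 101, 0 → 1 on the alphabet {0,1}. -/
def tau (b : ℕ) : List ℕ := if b = 1 then [1, 0, 1] else [1]

/-- The iterated word τ^n(1). -/
def tauIter : ℕ → List ℕ
  | 0 => [1]
  | n + 1 => ((tauIter n).map tau).flatten

/-- `s` is the fixed point of τ beginning with 1: it agrees with every
iterate `τ^n(1)` on its length. -/
def IsFixedSeq (s : ℕ → ℕ) : Prop :=
  ∀ n j, j < (tauIter n).length → s j = (tauIter n).getD j 0

/-- The sequence (f_n): f_0 = 1, f_1 = 2, f_{2n+2} = f_{2n} + f_{2n+1},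
f_{2n+3} = f_{2n} + f_{2n+2}. -/
def IsFSeq (f : ℕ → ℕ) : Prop :=
  f 0 = 1 ∧ f 1 = 2 ∧ (∀ n, f (2*n+2) = f (2*n) + f (2*n+1)) ∧
    (∀ n, f (2*n+3) = f (2*n) + f (2*n+2))

/-- `a` is the f-representation of `n`: digits in {0,1}, finitely supported,
a_i a_{i+1} = 0 for all i, a_i a_{i+2} = 0 for even i, and n = Σ a_i f_i. -/
def IsFRep (f : ℕ → ℕ) (n : ℕ) (a : ℕ → ℕ) : Prop :=
  (∀ i, a i ≤ 1) ∧ (∀ i, a i * a (i+1) = 0) ∧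
  (∀ i, Even i → a i * a (i+2) = 0) ∧
  ∃ N, (∀ i, N ≤ i → a i = 0) ∧ n = ∑ i ∈ Finset.range N, a i * f i

/-- The truncated f-representation Φ_k(n) = Σ_{i=0}^{2k+2} a_i(n) f_i. -/
def Phi (f : ℕ → ℕ) (a : ℕ → ℕ → ℕ) (k n : ℕ) : ℕ :=
  ∑ i ∈ Finset.range (2*k+3), a n i * f i

/-- The Hankel determinant H_{m,n} = det (s_{m+i+j})_{0 ≤ i,j ≤ n-1}. -/
def H (s : ℕ → ℕ) (m n : ℕ) : ℤ :=
  (Matrix.of fun i j : Fin n => (s (m + i.1 + j.1) : ℤ)).det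

/-! ### Determinant lemmas -/

def DD (n : ℕ) (F : ℕ → ℕ → ℤ) : ℤ := (Matrix.of fun i j : Fin n => F i.1 j.1).det

lemma DD_congr {n : ℕ} {F G : ℕ → ℕ → ℤ} (h : ∀ i j, i < n → j < n → F i j = G i j) :
    DD n F = DD n G := by
  unfold DD
  congr 1
  ext i j
  exact h _ _ i.2 j.2

lemma DD_peel (n : ℕ) (F : ℕ → ℕ → ℤ) (i0 j0 : ℕ) (hi : i0 < n + 1) (hj : j0 < n + 1)
    (h : ∀ j, j < n + 1 → j ≠ j0 → F i0 j = 0) :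
    DD (n+1) F = (-1)^(i0+j0) * F i0 j0 *
      DD n (fun i j => F (if i < i0 then i else i+1) (if j < j0 then j else j+1)) := by
  unfold DD
  rw [Matrix.det_succ_row _ (⟨i0, hi⟩ : Fin (n+1))]
  rw [Finset.sum_eq_single (⟨j0, hj⟩ : Fin (n+1))]
  · simp only [Matrix.of_apply]
    congr 2
    ext i j
    simp only [Matrix.submatrix_apply, Matrix.of_apply, Fin.succAbove]
    congr 1
    · by_cases hc : i.1 < i0 <;> simp [hc, Fin.lt_def]
    · by_cases hc : j.1 < j0 <;> simp [hc, Fin.lt_def]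
  · intro j _ hne
    have : F i0 j.1 = 0 := h _ j.2 (fun hh => hne (Fin.ext hh))
    simp [this]
  · simp

def sg (r : ℕ) : ℤ := (-1 : ℤ)^(r*(r-1)/2)

lemma sg_succ (r : ℕ) : sg (r+1) = (-1)^r * sg r := by
  unfold sg
  rw [Nat.triangle_succ, pow_add, mul_comm]

lemma sg_add (p r : ℕ) : sg (p+r) = sg p * sg r * (-1)^(p*r) := by
  induction r with
  | zero => simp [sg]
  | succ r ih =>
    rw [← add_assoc, sg_succ, ih, sg_succ, Nat.mul_succ]
    ring

lemma DD_right (c : ℕ) (e : ℤ) : ∀ (r : ℕ) (F : ℕ → ℕ → ℤ),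
    (∀ i j, c ≤ i → i < c + r → j < c + r → i + j + 1 < 2*c+r → F i j = 0) →
    (∀ i j, c ≤ i → i < c + r → j < c + r → i + j + 1 = 2*c+r → F i j = e) →
    DD (c+r) F = sg r * e^r * DD c F := by
  intro r
  induction r with
  | zero => intro F _ _; simp [sg]
  | succ r ih =>
    intro F h0 h1
    rw [← add_assoc, DD_peel (c+r) F c (c+r) (by omega) (by omega)
      (fun j hj hne => h0 c j le_rfl (by omega) (by omega) (by omega)),
      h1 c (c+r) le_rfl (by omega) (by omega) (by omega), ih]
    · rw [sg_succ, DD_congr (F := fun i j => F (if i < c then i else i+1) _) (G := F)]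
      · have : (-1 : ℤ)^(c + (c+r)) = (-1)^r := by
          rw [← add_assoc, pow_add, ← two_mul, pow_mul]; simp
        rw [this]; ring
      · intro i j hi hj
        rw [if_pos hi, if_pos (by omega)]
    · intro i j hi hi' hj hij
      rw [if_neg (by omega), if_pos (by omega)]
      exact h0 _ _ (by omega) (by omega) (by omega) (by omega)
    · intro i j hi hi' hj hij
      rw [if_neg (by omega), if_pos (by omega)]
      exact h1 _ _ (by omega) (by omega) (by omega) (by omega)

lemma DD_left (b : ℕ) (hb : Even b) (d : ℤ) : ∀ (p : ℕ) (F : ℕ → ℕ → ℤ),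
    (∀ i j, b ≤ i → i < b + p → j < b + p → b + p ≤ i + j → F i j = 0) →
    (∀ i j, b ≤ i → i < b + p → j < b + p → i + j + 1 = b + p → F i j = d) →
    DD (b+p) F = sg p * d^p * DD b (fun i j => F i (j+p)) := by
  intro p
  induction p with
  | zero => intro F _ _; simp [sg]
  | succ p ih =>
    intro F h0 h1
    rw [← add_assoc, DD_peel (b+p) F (b+p) 0 (by omega) (by omega)
      (fun j hj hne => h0 (b+p) j (by omega) (by omega) (by omega) (by omega)),
      h1 (b+p) 0 (by omega) (by omega) (by omega) (by omega), ih]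
    · rw [sg_succ, DD_congr (n := b) (G := fun i j => F i (j+(p+1)))]
      · have : (-1 : ℤ)^(b + p + 0) = (-1)^p := by
          rw [add_zero, pow_add, hb.neg_one_pow, one_mul]
        rw [this]; ring
      · intro i j hi hj
        rw [if_pos (by omega), if_neg (by omega)]
        rfl
    · intro i j hi hi' hj hij
      rw [if_pos (by omega), if_neg (by omega)]
      exact h0 _ _ (by omega) (by omega) (by omega) (by omega)
    · intro i j hi hi' hj hij
      rw [if_pos (by omega), if_neg (by omega)]
      exact h1 _ _ (by omega) (by omega) (by omega) (by omega)

lemma DD_rowop (n b : ℕ) (hb : 0 < b) (F : ℕ → ℕ → ℤ) :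
    DD n F = DD n (fun i j => if i < b then F i j else F i j - F (i-b) j) := by
  let U : Matrix (Fin n) (Fin n) ℤ :=
    Matrix.of fun i l => (if i = l then 1 else 0) - (if l.1 + b = i.1 then 1 else 0)
  have hU : U.det = 1 := by
    rw [Matrix.det_of_isLowerTriangular]
    · apply Finset.prod_eq_one
      intro i _
      simp [U]
      omega
    · intro i j hij
      have hij' : i.1 < j.1 := by simpa using hij
      have h1 : i ≠ j := fun h => by rw [h] at hij'; omega
      have h2 : ¬ (j.1 + b = i.1) := by omega
      simp [U, h1, h2]
  have hM : U * (Matrix.of fun i j : Fin n => F i.1 j.1) =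
      Matrix.of fun i j : Fin n => if i.1 < b then F i.1 j.1 else F i.1 j.1 - F (i.1-b) j.1 := by
    ext i j
    simp only [Matrix.mul_apply, U, Matrix.of_apply, sub_mul, Finset.sum_sub_distrib]
    have e1 : ∑ x : Fin n, (if i = x then (1:ℤ) else 0) * F x.1 j.1 = F i.1 j.1 := by
      simp [ite_mul]
    rw [e1]
    by_cases hc : i.1 < b
    · rw [if_pos hc, Finset.sum_eq_zero]
      · simp
      · intro x _
        rw [if_neg (by omega), zero_mul]
    · rw [if_neg hc, Finset.sum_eq_single (⟨i.1 - b, by omega⟩ : Fin n)]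
      · rw [if_pos (by simp; omega), one_mul]
      · intro x _ hx
        rw [if_neg, zero_mul]
        intro h
        exact hx (Fin.ext (by simp; omega))
      · simp
  unfold DD
  rw [← hM, Matrix.det_mul, hU, one_mul]

lemma H_eq_DD (s : ℕ → ℕ) (m n : ℕ) : H s m n = DD n (fun i j => (s (m+i+j) : ℤ)) := rfl

/-- Main determinant evaluation. -/
lemma H_eval (s : ℕ → ℕ) (M b p r : ℕ) (hb : Even b) (hb0 : 0 < b) (d e : ℤ)
    (hper : ∀ x, M + p ≤ x → x + 2 ≤ M + p + p + b + r → s (x + b) = s x)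
    (hd : 0 < p → (s (M + p - 1 + b) : ℤ) - s (M+p-1) = d)
    (he : 0 < r → (s (M + p + p + b + r - 1 + b) : ℤ) - s (M + p + p + b + r - 1) = e) :
    H s M (b+p+r) = sg p * d^p * (sg r * e^r) * H s (M+p) b := by
  rw [H_eq_DD, DD_rowop _ b hb0, DD_right (b+p) e r, DD_left b hb d p]
  · rw [H_eq_DD, DD_congr (n := b) (G := fun i j => (s (M+p+i+j) : ℤ))]
    · ring
    · intro i j hi hj
      rw [if_pos hi]
      congr 2
      omega
  · intro i j h1 h2 h3 h4
    rw [if_neg (by omega)]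
    have := hper (M + (i-b) + j) (by omega) (by omega)
    rw [← this, sub_eq_zero]
    congr 2
    omega
  · intro i j h1 h2 h3 h4
    rw [if_neg (by omega), ← hd (by omega)]
    congr 3 <;> omega
  · intro i j h1 h2 h3 h4
    rw [if_neg (by omega)]
    have := hper (M + (i-b) + j) (by omega) (by omega)
    rw [← this, sub_eq_zero]
    congr 2
    omega
  · intro i j h1 h2 h3 h4
    rw [if_neg (by omega), ← he (by omega)]
    congr 3 <;> omega

lemma H_rot (s : ℕ → ℕ) (A b : ℕ) (hb : Even b) (hb0 : 0 < b)
    (hper : ∀ x, A ≤ x → x < A + b → s (x + b) = s x) :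
    H s (A+1) b = - H s A b := by
  obtain ⟨c, rfl⟩ : ∃ c, b = c + 1 := ⟨b - 1, by omega⟩
  have key : (Matrix.of fun i j : Fin (c+1) => (s (A + 1 + i.1 + j.1) : ℤ)) =
      (Matrix.of fun i j : Fin (c+1) => (s (A + i.1 + j.1) : ℤ)).submatrix (finRotate (c+1)) id := by
    ext i j
    simp only [Matrix.submatrix_apply, Matrix.of_apply, id]
    by_cases hi : i = Fin.last c
    · subst hi
      rw [finRotate_last]
      have := hper (A + j.1) (by omega) (by omega)
      simp only [Fin.val_last, Fin.val_zero, add_zero]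
      rw [← this]
      congr 2
      omega
    · have : ((finRotate (c+1)) i).1 = i.1 + 1 := coe_finRotate_of_ne_last hi
      rw [this]
      congr 2
      omega
  unfold H
  rw [key, Matrix.det_permute, sign_finRotate]
  have : Odd c := by
    rcases Nat.even_or_odd c with h | h
    · exact absurd hb (by simp [h, parity_simps])
    · exact h
  simp [this.neg_one_pow]

lemma H_rot_iter (s : ℕ → ℕ) (A b : ℕ) (hb : Even b) (hb0 : 0 < b) (r : ℕ)
    (hper : ∀ x, A ≤ x → x + 1 < A + b + r → s (x + b) = s x) :
    H s (A+r) b = (-1)^r * H s A b := by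
  induction r with
  | zero => simp
  | succ r ih =>
    rw [← add_assoc, H_rot s (A+r) b hb hb0 (fun x h1 h2 => hper x (by omega) (by omega)),
      ih (fun x h1 h2 => hper x h1 (by omega)), pow_succ]
    ring

/-! ### The word -/

def AE : ℕ → ℕ × ℕ
  | 0 => (1, 1)
  | k+1 => (2 * (AE k).1 + (AE k).2, (AE k).1)

def LA (k : ℕ) : ℕ := (AE k).1
def LB (k : ℕ) : ℕ := (AE k).2

lemma LA_succ (k : ℕ) : LA (k+1) = 2 * LA k + LB k := rfl
lemma LB_succ (k : ℕ) : LB (k+1) = LA k := rfl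
lemma LA_zero : LA 0 = 1 := rfl
lemma LB_zero : LB 0 = 1 := rfl

lemma LAE_bd (k : ℕ) : 1 ≤ LB k ∧ LB k ≤ LA k ∧ LA k % 2 = 1 ∧ LB k % 2 = 1 := by
  induction k with
  | zero => simp [LA_zero, LB_zero]
  | succ k ih => rw [LA_succ, LB_succ]; omega

lemma f_eq {f : ℕ → ℕ} (hf : IsFSeq f) (k : ℕ) :
    f (2*k) = LA k ∧ f (2*k+1) = LA k + LB k := by
  obtain ⟨h0, h1, h2, h3⟩ := hf
  induction k with
  | zero => simp [h0, h1, LA_zero, LB_zero]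
  | succ k ih =>
    have e1 := h2 k
    have e2 := h3 k
    rw [LA_succ, LB_succ]
    constructor
    · rw [show 2*(k+1) = 2*k+2 by ring]; omega
    · rw [show 2*(k+1)+1 = 2*k+3 by ring]; omega

def LL (s : ℕ → ℕ) (k y : ℕ) : ℕ := ∑ i ∈ Finset.range y, if s i = 1 then LA k else LB k

lemma LL_zero (s : ℕ → ℕ) (k : ℕ) : LL s k 0 = 0 := by simp [LL]

lemma LL_one {s : ℕ → ℕ} {k y : ℕ} (h : s y = 1) : LL s k (y+1) = LL s k y + LA k := by
  simp [LL, Finset.sum_range_succ, h]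

lemma LL_nil {s : ℕ → ℕ} {k y : ℕ} (h : s y = 0) : LL s k (y+1) = LL s k y + LB k := by
  simp [LL, Finset.sum_range_succ, h]

/-- The properties of the fixed point that we use. -/
structure Good (s : ℕ → ℕ) : Prop where
  bin : ∀ y, s y = 0 ∨ s y = 1
  zero : s 0 = 1
  blk : ∀ y, s (LL s 1 y) = 1
  blk1 : ∀ y, s y = 1 → s (LL s 1 y + 1) = 0 ∧ s (LL s 1 y + 2) = 1

lemma tau_len (b : ℕ) : (tau b).length = if b = 1 then 3 else 1 := by
  unfold tau; split <;> rfl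

lemma tau_flat_len (l : List ℕ) : l.length ≤ ((l.map tau).flatten).length := by
  induction l with
  | nil => simp
  | cons x l ih =>
    simp only [List.map_cons, List.flatten_cons, List.length_append, List.length_cons, tau_len]
    split <;> omega

lemma tauIter_head (n : ℕ) : ∃ l, tauIter n = 1 :: l ∧ n ≤ l.length := by
  induction n with
  | zero => exact ⟨[], rfl, le_rfl⟩
  | succ n ih =>
    obtain ⟨l, hl, hn⟩ := ih
    refine ⟨[0,1] ++ (l.map tau).flatten, ?_, ?_⟩
    · simp [tauIter, hl, tau]
    · have := tau_flat_len l
      simp only [List.length_append, List.length_cons]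
      omega

lemma tauIter_len (n : ℕ) : n < (tauIter n).length := by
  obtain ⟨l, hl, hn⟩ := tauIter_head n
  rw [hl]; simp; omega

lemma tauIter_bin (n : ℕ) : ∀ x ∈ tauIter n, x = 0 ∨ x = 1 := by
  induction n with
  | zero => simp [tauIter]
  | succ n ih =>
    intro x hx
    simp only [tauIter, List.mem_flatten, List.mem_map] at hx
    obtain ⟨l, ⟨b, _, rfl⟩, hx⟩ := hx
    unfold tau at hx
    split at hx <;> simp at hx <;> omega

lemma flat_len_LL (s : ℕ → ℕ) (w : List ℕ) (y : ℕ) (hy : y ≤ w.length)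
    (hw : ∀ j, j < w.length → s j = w.getD j 0) :
    (((w.take y).map tau).flatten).length = LL s 1 y := by
  induction y with
  | zero => simp [LL]
  | succ y ih =>
    have hy' : y < w.length := by omega
    have h1 := ih (by omega)
    have h2 := hw y hy'
    rw [List.getD_eq_getElem _ _ hy'] at h2
    rw [List.take_add_one, List.getElem?_eq_getElem hy']
    simp only [Option.toList_some, List.map_append, List.map_cons, List.map_nil,
      List.flatten_append, List.flatten_cons, List.flatten_nil, List.append_nil,
      List.length_append, h1, tau_len, ← h2]
    rw [LL, LL, Finset.sum_range_succ]
    rfl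

lemma good_aux {s : ℕ → ℕ} (hs : IsFixedSeq s) (y j : ℕ) (hj : j < (tau (s y)).length) :
    s (LL s 1 y + j) = (tau (s y)).getD j 0 := by
  have hy := tauIter_len y
  set w := tauIter y with hw
  have hsw : ∀ j, j < w.length → s j = w.getD j 0 := fun j hj => hs y j hj
  have hlen := flat_len_LL s w y hy.le hsw
  have hsy : s y = w[y] := by rw [hsw y hy, List.getD_eq_getElem _ _ hy]
  have hdec : tauIter (y+1) = ((w.take y).map tau).flatten ++
      (tau (s y) ++ ((w.drop (y+1)).map tau).flatten) := by
    have : w = w.take y ++ (w[y] :: w.drop (y+1)) := by simp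
    have h2 : (w.map tau).flatten = ((w.take y ++ (w[y] :: w.drop (y+1))).map tau).flatten := by
      rw [← this]
    rw [List.map_append, List.flatten_append, List.map_cons, List.flatten_cons, ← hsy] at h2
    exact h2
  have hlt : LL s 1 y + j < (tauIter (y+1)).length := by
    rw [hdec]; simp only [List.length_append, hlen]; omega
  rw [hs (y+1) _ hlt, hdec, List.getD_append_right _ _ _ _ (by omega), hlen, Nat.add_sub_cancel_left,
    List.getD_append _ _ _ _ hj]

lemma good_of_fixed {s : ℕ → ℕ} (hs : IsFixedSeq s) : Good s := by
  refine ⟨?_, ?_, ?_, ?_⟩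
  · intro y
    have hy := tauIter_len y
    rw [hs y y hy, List.getD_eq_getElem _ _ hy]
    exact tauIter_bin y _ (List.getElem_mem hy)
  · rw [hs 0 0 (by simp [tauIter])]; rfl
  · intro y
    have := good_aux hs y 0 (by rw [tau_len]; split <;> omega)
    rw [add_zero] at this
    rw [this]
    unfold tau; split <;> rfl
  · intro y hy
    have h1 := good_aux hs y 1 (by rw [tau_len]; simp [hy])
    have h2 := good_aux hs y 2 (by rw [tau_len]; simp [hy])
    rw [h1, h2]
    simp [tau, hy]

namespace Good

variable {s : ℕ → ℕ}

lemma blk3 (g : Good s) (y : ℕ) (hy : s y = 1) : s (LL s 1 y + 3) = 1 := by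
  have := g.blk (y+1)
  rw [LL_one hy] at this
  exact this

lemma comp (g : Good s) (k y : ℕ) : LL s (k+1) y = LL s k (LL s 1 y) := by
  induction y with
  | zero => simp [LL]
  | succ y ih =>
    rcases g.bin y with h | h
    · rw [LL_nil h, LL_nil h, ih]
      exact (LL_one (g.blk y)).symm
    · have h1 := g.blk1 y h
      rw [LL_one h, LL_one h, ih, LA_succ]
      show _ = LL s k (LL s 1 y + 1 + 1 + 1)
      rw [LL_one h1.2, LL_nil h1.1, LL_one (g.blk y)]
      ring

/-- blocks of type one are prefixes -/
lemma pre (g : Good s) (k : ℕ) : ∀ y, s y = 1 → ∀ j, j < LA k → s (LL s k y + j) = s j := by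
  -- any two such blocks agree
  suffices h : ∀ k, (∀ y y', s y = s y' → ∀ j, j < (if s y = 1 then LA k else LB k) →
      s (LL s k y + j) = s (LL s k y' + j)) by
    intro y hy j hj
    have := h k y 0 (by rw [hy, g.zero]) j (by simpa [hy] using hj)
    rw [this, LL_zero, zero_add]
  intro k
  induction k with
  | zero =>
    intro y y' h j hj
    have hL : ∀ y, LL s 0 y = y := by
      intro y; simp [LL, LA_zero, LB_zero]
    have : j = 0 := by
      rw [LA_zero, LB_zero] at hj
      split at hj <;> omega
    subst this
    rw [hL, hL]; exact h
  | succ k ih =>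
    intro y y' h j hj
    rw [g.comp k y, g.comp k y']
    have b0 := g.blk y
    have b0' := g.blk y'
    have i0 := ih _ _ (b0.trans b0'.symm)
    rw [if_pos b0] at i0
    rcases g.bin y with hy | hy
    · rw [if_neg (by omega), LB_succ] at hj
      exact i0 j hj
    · rw [if_pos hy, LA_succ] at hj
      have b1 := g.blk1 y hy
      have b1' := g.blk1 y' (h ▸ hy)
      by_cases c1 : j < LA k
      · exact i0 j c1
      have e1 := LL_one (k := k) b0
      have e1' := LL_one (k := k) b0'
      by_cases c2 : j < LA k + LB k
      · have := ih _ _ (b1.1.trans b1'.1.symm) (j - LA k)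
        rw [if_neg (by omega)] at this
        have := this (by omega)
        rw [e1, e1'] at this
        convert this using 2 <;> omega
      · have e2 : LL s k (LL s 1 y + 2) = _ := LL_nil (k := k) b1.1
        have e2' : LL s k (LL s 1 y' + 2) = _ := LL_nil (k := k) b1'.1
        have := ih _ _ (b1.2.trans b1'.2.symm) (j - LA k - LB k)
        rw [if_pos b1.2] at this
        have := this (by omega)
        rw [e2, e2', e1, e1'] at this
        convert this using 2 <;> omega

/-- blocks of type zero are prefixes, for positive levels -/
lemma pre0 (g : Good s) (k : ℕ) (y : ℕ) (j : ℕ) (hj : j < LB (k+1)) :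
    s (LL s (k+1) y + j) = s j := by
  rw [g.comp]
  exact g.pre k _ (g.blk y) j hj

lemma self_mid (g : Good s) (k j : ℕ) (hj : j < LB (k+1)) : s (j + LA (k+1)) = s j := by
  have h := g.pre0 k 1 j hj
  have e : LL s (k+1) 1 = LL s (k+1) 0 + LA (k+1) := LL_one g.zero
  rw [e, LL_zero] at h
  rw [← h]; congr 1; omega

lemma self_last (g : Good s) (k j : ℕ) (hj : j < LA k) : s (j + LA k + LB k) = s j := by
  have b := g.blk1 0 g.zero
  rw [LL_zero] at b
  have h := g.pre k 2 b.2 j hj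
  have e : LL s k 1 = LL s k 0 + LA k := LL_one g.zero
  have e2 : LL s k 2 = LL s k 1 + LB k := LL_nil b.1
  rw [e2, e, LL_zero] at h
  rw [← h]; congr 1; omega

lemma suffix (g : Good s) (k z : ℕ) (hz : z < LB (k+1)) : s (LA (k+1) - LB (k+1) + z) = s z := by
  rw [← g.self_last k z hz]
  congr 1
  rw [LA_succ, LB_succ]
  omega

lemma almost (g : Good s) (k : ℕ) : ∃ u, 2*u + 2 + LB (k+1) = LA (k+1) ∧
    (∀ w, w < u → s (w + LB (k+1)) = s w) ∧
    (∀ w, u + 2 ≤ w → w + LB (k+1) < LA (k+1) → s (w + LB (k+1)) = s w) ∧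
    (s (u + LB (k+1)) : ℤ) - s u = (-1)^(k+1) ∧
    (s (u + 1 + LB (k+1)) : ℤ) - s (u+1) = (-1)^(k+2) := by
  induction k with
  | zero =>
    have b := g.blk1 0 g.zero
    rw [LL_zero] at b
    refine ⟨0, rfl, by simp, ?_, ?_, ?_⟩
    · intro w h1 h2
      simp [LA_succ, LB_succ, LA_zero, LB_zero] at h2
      omega
    · simp [LB_succ, LA_zero, b.1, g.zero]
    · simp [LB_succ, LA_zero, b.1]
      simpa using b.2
  | succ k ih =>
    obtain ⟨u, h0, h1, h2, h3, h4⟩ := ih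
    have bd := LAE_bd (k+1)
    have hLA := LA_succ (k+1)
    have hLE := LB_succ (k+1)
    have mid := g.self_mid k
    have last := g.self_last (k+1)
    have suf := g.suffix k
    have step : ∀ w, w < LA (k+1) - LB (k+1) →
        s (w + LB (k+1) + LA (k+1)) = s w := by
      intro w hw
      rw [← last w (by omega)]; congr 1; omega
    refine ⟨LB (k+1) + u, by omega, ?_, ?_, ?_, ?_⟩
    · intro w hw
      rw [hLE]
      by_cases c : w < LB (k+1)
      · exact mid w c
      · obtain ⟨v, rfl⟩ := Nat.exists_eq_add_of_le' (not_lt.mp c)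
        rw [step v (by omega), h1 v (by omega)]
    · intro w hw hw'
      rw [hLE] at hw' ⊢
      by_cases c : w < LA (k+1)
      · obtain ⟨v, rfl⟩ := Nat.exists_eq_add_of_le' (show LB (k+1) ≤ w by omega)
        rw [step v (by omega), h2 v (by omega) (by omega)]
      · obtain ⟨z, rfl⟩ := Nat.exists_eq_add_of_le' (not_lt.mp c)
        rw [mid z (by omega), ← suf z (by omega),
          ← last (LA (k+1) - LB (k+1) + z) (by omega)]
        congr 1; omega
    · rw [hLE, add_comm (LB (k+1)) u, step u (by omega), pow_succ, ← h3]; ring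
    · rw [hLE, show LB (k+1) + u + 1 = (u + 1) + LB (k+1) by ring, step (u+1) (by omega),
        show k + 1 + 2 = (k+2)+1 by ring, pow_succ, ← h4]; ring

/-- digits -/
lemma digits (g : Good s) {f : ℕ → ℕ} (hf : IsFSeq f) : ∀ (N : ℕ) (c : ℕ → ℕ),
    (∀ i, c i ≤ 1) → (∀ i, c i * c (i+1) = 0) → (∀ i, Even i → c i * c (i+2) = 0) →
    (∀ i, 2*N ≤ i → c i = 0) →
    s (∑ i ∈ Finset.range (2*N), c i * f i) = 1 - c 0 ∧
    ∀ k, LL s k (∑ i ∈ Finset.range (2*N), c i * f i) =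
      ∑ i ∈ Finset.range (2*N), c i * f (i + 2*k) := by
  intro N
  induction N with
  | zero =>
    intro c _ _ _ h
    simp [LL_zero, g.zero, h 0]
  | succ N ih =>
    intro c h1 h2 h3 h4
    obtain ⟨i1, i2⟩ := ih (fun i => c (i+2)) (fun i => h1 _) (fun i => h2 (i+2))
      (fun i hi => h3 (i+2) (by simp [hi, parity_simps])) (fun i hi => h4 _ (by omega))
    have split : ∀ F : ℕ → ℕ, ∑ i ∈ Finset.range (2*(N+1)), c i * F i =
        ∑ i ∈ Finset.range (2*N), c (i+2) * F (i+2) + c 1 * F 1 + c 0 * F 0 := by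
      intro F
      rw [show 2*(N+1) = 2*N+1+1 by ring, Finset.sum_range_succ', Finset.sum_range_succ']
    set y' := ∑ i ∈ Finset.range (2*N), c (i+2) * f i with hy'
    have e0 := i2 1
    have f0 : f 0 = 1 := hf.1
    have f1 : f 1 = 2 := hf.2.1
    have ey : ∑ i ∈ Finset.range (2*(N+1)), c i * f i = LL s 1 y' + 2 * c 1 + c 0 := by
      rw [split, e0, f0, f1]; ring
    have eS : ∀ k, ∑ i ∈ Finset.range (2*(N+1)), c i * f (i + 2*k) =
        LL s k (LL s 1 y') + c 1 * (LA k + LB k) + c 0 * LA k := by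
      intro k
      rw [split (fun i => f (i + 2*k)), ← g.comp, i2 (k+1)]
      have := f_eq hf k
      rw [zero_add, add_comm 1 (2*k), this.1, this.2]
      congr 3
      funext i
      rw [show i + 2*(k+1) = i + 2 + 2*k by ring]
    rw [ey]
    simp only [eS]
    have hb := g.blk y'
    simp only [zero_add] at i1
    have q0 := h1 0
    have q1 := h1 1
    have m01 : c 0 * c 1 = 0 := h2 0
    have m12 : c 1 * c 2 = 0 := h2 1
    have m02 : c 0 * c 2 = 0 := h3 0 (by simp)
    rcases Nat.le_one_iff_eq_zero_or_eq_one.mp q0 with z0 | z0 <;>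
    rcases Nat.le_one_iff_eq_zero_or_eq_one.mp q1 with z1 | z1
    · simp [z0, z1, hb]
    · have c2 : c 2 = 0 := by simpa [z1] using m12
      rw [c2] at i1
      have hb1 := g.blk1 y' i1
      rw [z0, z1]
      refine ⟨by simpa using hb1.2, fun k => ?_⟩
      show LL s k (LL s 1 y' + 1 + 1) = _
      rw [LL_nil hb1.1, LL_one hb]; ring
    · have c2 : c 2 = 0 := by simpa [z0] using m02
      rw [c2] at i1
      have hb1 := g.blk1 y' i1
      rw [z0, z1]
      refine ⟨by simpa using hb1.1, fun k => ?_⟩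
      show LL s k (LL s 1 y' + 1) = _
      rw [LL_one hb]; ring
    · simp [z0, z1] at m01

lemma locate (g : Good s) {f : ℕ → ℕ} (hf : IsFSeq f) (a : ℕ → ℕ → ℕ)
    (ha : ∀ n, IsFRep f n (a n)) (k γ : ℕ) (h : Phi f a k γ = f (2*k+3) / 2) :
    ∃ y, s y = 1 ∧ γ = LL s (k+1) y + f (2*k+3) / 2 := by
  obtain ⟨h1, h2, h3, N, h4, h5⟩ := ha γ
  set c := a γ with hc
  have hΦ : Phi f a k γ = ∑ i ∈ Finset.range (2*k+2), c i * f i + c (2*k+2) * f (2*k+2) := by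
    unfold Phi; rw [Finset.sum_range_succ]
  have hF3 : f (2*k+3) = LA (k+1) + LB (k+1) := (f_eq hf (k+1)).2
  have hF2 : f (2*k+2) = LA (k+1) := (f_eq hf (k+1)).1
  have bd := LAE_bd k
  have c0 : c (2*k+2) = 0 := by
    rcases Nat.le_one_iff_eq_zero_or_eq_one.mp (h1 (2*k+2)) with z | z
    · exact z
    · exfalso
      rw [hΦ, z, hF2, hF3, LA_succ, LB_succ] at h
      omega
  obtain ⟨d1, d2⟩ := g.digits hf N (fun i => c (2*k+2+i)) (fun i => h1 _) (fun i => h2 (2*k+2+i))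
      (fun i hi => h3 (2*k+2+i) (by simp [hi, parity_simps])) (fun i hi => h4 _ (by omega))
  refine ⟨_, by rw [d1]; simp [c0], ?_⟩
  rw [d2 (k+1), ← h, hΦ, c0, zero_mul, add_zero]
  have : γ = ∑ i ∈ Finset.range (2*k+2+2*N), c i * f i := by
    rw [h5]
    apply Finset.sum_subset
    · intro i hi; simp only [Finset.mem_range] at hi ⊢; omega
    · intro i _ hi
      rw [h4 i (by simpa using hi), zero_mul]
  rw [this, Finset.sum_range_add, add_comm]
  congr 1
  apply Finset.sum_congr rfl
  intro i _
  rw [show i + 2*(k+1) = 2*k+2+i by ring]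

/-- The local structure around `γ`. -/
lemma loc (g : Good s) (k y γ : ℕ) (hy : s y = 1)
    (hγ : γ = LL s (k+2) y + (LA (k+2) + LB (k+2)) / 2) :
    (∀ x, γ + 1 ≤ x + (2 * LA (k+1) + LB (k+1)) → x + 2 ≤ γ → s (x + (LA (k+1) + LB (k+1))) = s x ∨
        γ + 1 < 2 * LA (k+1) + LB (k+1)) ∧
    (s (γ - 1 + (LA (k+1) + LB (k+1))) : ℤ) - s (γ - 1) = (-1)^(k+1) ∧
    (2 * LA (k+1) + LB (k+1) ≤ γ →
      (s (γ - (2 * LA (k+1) + LB (k+1)) + (LA (k+1) + LB (k+1))) : ℤ)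
        - s (γ - (2 * LA (k+1) + LB (k+1))) = (-1)^(k+2)) := by
  obtain ⟨u, h0, h1, h2, h3, h4⟩ := g.almost k
  have bd := LAE_bd (k+1)
  have hLA : LA (k+2) = _ := LA_succ (k+1)
  have hLE : LB (k+2) = _ := LB_succ (k+1)
  have suf := g.suffix k
  have mid := g.self_mid k
  have b0 := g.blk y
  have b1 := g.blk1 y hy
  have b3 := g.blk3 y hy
  have X0 := g.pre (k+1) _ b0
  have Y1 := fun j hj => g.pre0 k (LL s 1 y + 1) j hj
  have X2 := g.pre (k+1) _ b1.2
  have X3 := g.pre (k+1) _ b3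
  have e1 : LL s (k+1) (LL s 1 y + 1) = _ := LL_one b0
  have e2 : LL s (k+1) (LL s 1 y + 2) = _ := LL_nil b1.1
  have e3 : LL s (k+1) (LL s 1 y + 3) = _ := LL_one b1.2
  rw [g.comp] at hγ
  rw [e3, e2, e1] at X3
  rw [e2, e1] at X2
  rw [e1] at Y1
  -- the preceding block
  have prev : LL s (k+1) (LL s 1 y) = 0 ∨ (LA (k+1) ≤ LL s (k+1) (LL s 1 y) ∧
      ∀ j, j < LA (k+1) → s (LL s (k+1) (LL s 1 y) - LA (k+1) + j) = s j) := by
    rcases Nat.eq_zero_or_pos y with rfl | hpos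
    · left; simp [LL_zero]
    · right
      obtain ⟨y', rfl⟩ : ∃ y', y = y' + 1 := ⟨y - 1, by omega⟩
      have hz : ∃ z, LL s 1 (y'+1) = z + 1 ∧ s z = 1 := by
        rcases g.bin y' with q | q
        · exact ⟨LL s 1 y', LL_nil q, g.blk y'⟩
        · exact ⟨LL s 1 y' + 2, LL_one q, (g.blk1 y' q).2⟩
      obtain ⟨z, hz, hz1⟩ := hz
      rw [hz, LL_one hz1]
      refine ⟨by omega, fun j hj => ?_⟩
      rw [Nat.add_sub_cancel]
      exact g.pre (k+1) z hz1 j hj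
  set G := LL s (k+1) (LL s 1 y) with hG
  set A := LA (k+1) with hA
  set E := LB (k+1) with hE
  have hγ' : γ = G + A + E + u + 1 := by omega
  clear hγ
  subst hγ'
  refine ⟨?_, ?_, ?_⟩
  · intro x hx hx'
    by_cases hsm : G + A + E + u + 1 + 1 < 2 * A + E
    · right; exact hsm
    left
    by_cases c0 : x < G
    · rcases prev with p | ⟨p1, p2⟩
      · omega
      obtain ⟨w, rfl⟩ : ∃ w, x = G - A + w := ⟨x - (G - A), by omega⟩
      rw [p2 w (by omega)]
      by_cases c : w + E < A
      · rw [← h2 w (by omega) c, ← X0 (w+E) c]; congr 1; omega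
      · obtain ⟨z, rfl⟩ : ∃ z, w = A - E + z := ⟨w - (A - E), by omega⟩
        rw [suf z (by omega), ← Y1 z (by omega)]; congr 1; omega
    by_cases c1 : x < G + A
    · obtain ⟨v, rfl⟩ := Nat.exists_eq_add_of_le (not_lt.mp c0)
      rw [X0 v (by omega), ← X2 v (by omega)]; congr 1; omega
    by_cases c2 : x < G + A + E
    · obtain ⟨v, rfl⟩ := Nat.exists_eq_add_of_le (not_lt.mp c1)
      rw [Y1 v (by omega), ← X3 v (by omega)]; congr 1; omega
    · obtain ⟨v, rfl⟩ := Nat.exists_eq_add_of_le (not_lt.mp c2)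
      rw [X2 v (by omega), ← h1 v (by omega), ← X3 (v+E) (by omega)]; congr 1; omega
  · rw [← h3, ← X2 u (by omega), ← X3 (u+E) (by omega)]
    congr 3 <;> omega
  · intro hle
    rcases prev with p | ⟨p1, p2⟩
    · omega
    rw [← h4, ← p2 (u+1) (by omega), ← X0 (u+1+E) (by omega)]
    congr 3 <;> omega

end Good

lemma npow_eq {m n : ℕ} (h : Even (m + n)) : (-1 : ℤ)^m = (-1)^n := by
  rcases Nat.even_or_odd m with hm | hm
  · rw [hm.neg_one_pow, ((Nat.even_add.mp h).mp hm).neg_one_pow]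
  · have : Odd n := by
      rw [← Nat.not_even_iff_odd] at hm ⊢
      exact fun hn => hm ((Nat.even_add.mp h).mpr hn)
    rw [hm.neg_one_pow, this.neg_one_pow]

lemma par_one (p r k : ℕ) (h : Even p ↔ Even r) :
    Even ((k+2)*p + (r*(k+1) + p*r + (k+2)*(p+r))) := by
  by_cases h1 : Even r <;> by_cases h2 : Even k <;> simp [h1, h2, h, parity_simps]

lemma par_two (p r k : ℕ) (h : Even p ↔ Even r) :
    Even ((k+1)*p + r + (r*(k+1) + p*r + (k+1)*(p+r))) := by
  by_cases h1 : Even r <;> by_cases h2 : Even k <;> simp [h1, h2, h, parity_simps]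

lemma par_three (p r k : ℕ) (h : Even p ↔ Even r) :
    Even ((k+2)*p + (k+1)*r + (p*r + (k+2)*(p+r))) := by
  by_cases h1 : Even r <;> by_cases h2 : Even k <;> simp [h1, h2, h, parity_simps]

lemma sg_sq (r : ℕ) : sg r * sg r = 1 := by
  unfold sg; rw [← mul_pow]; simp

theorem boundary_T (f : ℕ → ℕ) (hf : IsFSeq f) (s : ℕ → ℕ) (hs : IsFixedSeq s) (a : ℕ → ℕ → ℕ) (ha : ∀ n, IsFRep f n (a n)) :
    ∀ k γ r : ℕ,
      Phi f a k γ = f (2*k+3) / 2 →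
      r ≤ f (2*k) - 1 →
      (f (2*k+3) - 2 ≤ γ →
        H s (γ + 2 + r - f (2*k+3)) (f (2*k+2) - 1 - r) =
          (-1 : ℤ)^(r*k) * (-1 : ℤ)^(r*(r-1)/2) *
            H s (γ + 2 - f (2*k+3)) (f (2*k+2) - 1)) ∧
      (f (2*k+2) - 1 ≤ γ →
        H s (γ + 1 + r - f (2*k+2)) (f (2*k+2) - 1 - r) =
          (-1 : ℤ)^(r*k) * (-1 : ℤ)^(r*(r-1)/2) *
            H s (γ + 1 - f (2*k+2)) (f (2*k+2) - 1)) ∧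
      (f (2*k+3) - 2 ≤ γ →
        H s (γ + 2 + r - f (2*k+3)) (f (2*k+2) - 1) =
          H s (γ + 2 - f (2*k+3)) (f (2*k+2) - 1)) := by
  intro k γ r hΦ hr
  have g := good_of_fixed hs
  obtain ⟨y, hy, hγ⟩ := g.locate hf a ha k γ hΦ
  have F0 : f (2*k) = LA k := (f_eq hf k).1
  have F2 : f (2*k+2) = LA (k+1) := (f_eq hf (k+1)).1
  have F3 : f (2*k+3) = LA (k+1) + LB (k+1) := (f_eq hf (k+1)).2
  rcases k with _ | k
  · have : r = 0 := by rw [F0, LA_zero] at hr; omega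
    subst this
    simp
  rw [F3] at hγ
  obtain ⟨l1, l2, l3⟩ := g.loc k y γ hy hγ
  rw [LA_succ (k+1)] at F2
  rw [LA_succ (k+1), LB_succ (k+1)] at F3
  rw [F0] at hr
  have bd := LAE_bd (k+1)
  rw [F2, F3]
  have hA2 : LB (k+1) < LA (k+1) := by
    have := LAE_bd k
    rw [LA_succ, LB_succ]; omega
  set A := LA (k+1) with hA
  set E := LB (k+1) with hE
  obtain ⟨Q, hQ⟩ : ∃ Q, A = Q + 1 := ⟨A - 1, by omega⟩
  obtain ⟨p, hp⟩ : ∃ p, Q = p + r := ⟨Q - r, by omega⟩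
  have hQe : Even (p + r) := by rw [Nat.even_iff]; omega
  have hbe : Even (A + E) := by rw [Nat.even_iff]; omega
  have hb0 : 0 < A + E := by omega
  have hpr : (p % 2 = 0 ∧ r % 2 = 0) ∨ (p % 2 = 1 ∧ r % 2 = 1) := by
    rw [Nat.even_iff] at hQe; omega
  have hpe : Even p ↔ Even r := Nat.even_add.mp hQe
  have sq := sg_sq r
  clear hΦ hγ F0 F2 F3
  clear_value A E
  refine ⟨?_, ?_, ?_⟩
  · intro hg
    obtain ⟨M, hM⟩ : ∃ M, γ + 2 = M + (2*A+E+A) := ⟨γ + 2 - (2*A+E+A), by omega⟩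
    have E1 := H_eval s (M + r) (A+E) p 0 hbe hb0 ((-1)^(k+2)) 1
      (fun x hx hx' => (l1 x (by omega) (by omega)).resolve_right (by omega))
      (fun hp0 => by
        rw [← l3 (by omega)]
        congr 3 <;> omega)
      (fun h => absurd h (lt_irrefl _))
    have E2 := H_eval s M (A+E) Q 0 hbe hb0 ((-1)^(k+2)) 1
      (fun x hx hx' => (l1 x (by omega) (by omega)).resolve_right (by omega))
      (fun hp0 => by
        rw [← l3 (by omega)]
        congr 3 <;> omega)
      (fun h => absurd h (lt_irrefl _))
    rw [show γ + 2 + r - (2*A+E+A) = M + r by omega,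
      show γ + 2 - (2*A+E+A) = M by omega,
      show 2*A+E-1-r = A+E+p+0 by omega, show 2*A+E-1 = A+E+Q+0 by omega, E1, E2]
    rw [show M + r + p = M + Q by omega, hp, sg_add, ← sg.eq_1 r]
    have h : ((-1 : ℤ)^(k+2))^p =
        (-1)^(r*(k+1)) * (-1)^(p*r) * ((-1)^(k+2))^(p+r) := by
      rw [← pow_mul, ← pow_mul]
      simp only [← pow_add]
      apply npow_eq
      exact par_one p r k hpe
    rw [h]
    generalize ((-1 : ℤ)^(k+2))^(p+r) = D
    generalize (-1 : ℤ)^(r*(k+1)) = P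
    generalize (-1 : ℤ)^(p*r) = R
    linear_combination (-(sg p * (sg 0 * 1^0) * H s (M+(p+r)) (A+E) * P * R * D)) * sq
  · intro hg
    obtain ⟨M, hM⟩ : ∃ M, γ + 1 = M + (2*A+E) := ⟨γ + 1 - (2*A+E), by omega⟩
    have E1 := H_eval s (M + r) (A+E) 0 p hbe hb0 1 ((-1)^(k+1))
      (fun x hx hx' => (l1 x (by omega) (by omega)).resolve_right (by omega))
      (fun h => absurd h (lt_irrefl _))
      (fun hp0 => by
        rw [← l2]
        congr 3 <;> omega)
    have E2 := H_eval s M (A+E) 0 Q hbe hb0 1 ((-1)^(k+1))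
      (fun x hx hx' => (l1 x (by omega) (by omega)).resolve_right (by omega))
      (fun h => absurd h (lt_irrefl _))
      (fun hp0 => by
        rw [← l2]
        congr 3 <;> omega)
    have E3 := H_rot_iter s M (A+E) hbe hb0 r
      (fun x hx hx' => (l1 x (by omega) (by omega)).resolve_right (by omega))
    rw [show γ + 1 + r - (2*A+E) = M + r by omega,
      show γ + 1 - (2*A+E) = M by omega,
      show 2*A+E-1-r = A+E+0+p by omega, show 2*A+E-1 = A+E+0+Q by omega, E1, E2]
    rw [add_zero, add_zero, E3, hp, sg_add, ← sg.eq_1 r]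
    have h : ((-1 : ℤ)^(k+1))^p * (-1)^r =
        (-1)^(r*(k+1)) * (-1)^(p*r) * ((-1)^(k+1))^(p+r) := by
      rw [← pow_mul, ← pow_mul]
      simp only [← pow_add]
      apply npow_eq
      exact par_two p r k hpe
    generalize ((-1 : ℤ)^(k+1))^(p+r) = D at *
    generalize (-1 : ℤ)^(r*(k+1)) = P at *
    generalize (-1 : ℤ)^(p*r) = R at *
    generalize ((-1 : ℤ)^(k+1))^p = Z at *
    generalize (-1 : ℤ)^r = W at *
    linear_combination (sg 0 * 1^0 * sg p * H s M (A+E)) * h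
      - (sg p * (sg 0 * 1^0) * H s M (A+E) * P * R * D) * sq
  · intro hg
    obtain ⟨M, hM⟩ : ∃ M, γ + 2 = M + (2*A+E+A) := ⟨γ + 2 - (2*A+E+A), by omega⟩
    have E1 := H_eval s (M + r) (A+E) p r hbe hb0 ((-1)^(k+2)) ((-1)^(k+1))
      (fun x hx hx' => (l1 x (by omega) (by omega)).resolve_right (by omega))
      (fun hp0 => by
        rw [← l3 (by omega)]
        congr 3 <;> omega)
      (fun hp0 => by
        rw [← l2]
        congr 3 <;> omega)
    have E2 := H_eval s M (A+E) Q 0 hbe hb0 ((-1)^(k+2)) 1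
      (fun x hx hx' => (l1 x (by omega) (by omega)).resolve_right (by omega))
      (fun hp0 => by
        rw [← l3 (by omega)]
        congr 3 <;> omega)
      (fun h => absurd h (lt_irrefl _))
    rw [show γ + 2 + r - (2*A+E+A) = M + r by omega,
      show γ + 2 - (2*A+E+A) = M by omega]
    nth_rewrite 1 [show 2*A+E-1 = A+E+p+r by omega]
    rw [show 2*A+E-1 = A+E+Q+0 by omega, E1, E2]
    rw [show M + r + p = M + Q by omega, hp, sg_add]
    have h : ((-1 : ℤ)^(k+2))^p * ((-1)^(k+1))^r =
        (-1)^(p*r) * ((-1)^(k+2))^(p+r) := by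
      rw [← pow_mul, ← pow_mul, ← pow_mul]
      simp only [← pow_add]
      apply npow_eq
      exact par_three p r k hpe
    have z : sg 0 = 1 := by simp [sg]
    rw [z]
    generalize ((-1 : ℤ)^(k+2))^(p+r) = D at *
    generalize (-1 : ℤ)^(p*r) = R at *
    generalize ((-1 : ℤ)^(k+2))^p = Z at *
    generalize ((-1 : ℤ)^(k+1))^r = W at *
    linear_combination (sg p * sg r * H s (M+(p+r)) (A+E)) * h
end

section
/- For every integer k ≥ 1 and every element γ ∈ E'_k with γ > f_{2k+3}/2 (i.e. γ is not the smallest element of E'_k), the Hankel determinant at the lower left corner of the parallelogram T_k satisfies H_{γ−f_{2k+2}+1, f_{2k+1}} = (−1)^k · (H_{γ−f_{2k+2}+2, f_{2k+1}−1} + H_{γ−f_{2k+2}+1, f_{2k+1}−1}). -/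
/-- The pair (τ^k(1), τ^k(0)). -/
def wAB : ℕ → List ℕ × List ℕ
  | 0 => ([1], [0])
  | n + 1 => ((wAB n).1 ++ (wAB n).2 ++ (wAB n).1, (wAB n).1)

lemma tau_wAB (n : ℕ) : (((wAB n).1).map tau).flatten = (wAB (n+1)).1 ∧
    (((wAB n).2).map tau).flatten = (wAB (n+1)).2 := by
  induction n with
  | zero => simp [wAB, tau]
  | succ n ih =>
    obtain ⟨h1, h2⟩ := ih
    have e1 : (wAB (n+1)).1 = (wAB n).1 ++ (wAB n).2 ++ (wAB n).1 := rfl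
    have e2 : (wAB (n+1)).2 = (wAB n).1 := rfl
    have e3 : (wAB (n+1+1)).1 = (wAB (n+1)).1 ++ (wAB (n+1)).2 ++ (wAB (n+1)).1 := rfl
    have e4 : (wAB (n+1+1)).2 = (wAB (n+1)).1 := rfl
    constructor
    · rw [e3]
      conv_lhs => rw [e1]
      simp only [List.map_append, List.flatten_append, h1, h2]
    · rw [e4, e2, h1]

lemma tauIter_eq (n : ℕ) : tauIter n = (wAB n).1 := by
  induction n with
  | zero => rfl
  | succ n ih =>
    rw [tauIter, ih, (tau_wAB n).1]

lemma wAB_len (f : ℕ → ℕ) (hf : IsFSeq f) (n : ℕ) : (wAB n).1.length = f (2*n) ∧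
    (wAB n).1.length + (wAB n).2.length = f (2*n+1) ∧ (wAB n).2.length ≤ (wAB n).1.length := by
  obtain ⟨h0, h1, h2, h3⟩ := hf
  induction n with
  | zero => simp [wAB, h0, h1]
  | succ n ih =>
    have a1 := h2 n
    have a2 := h3 n
    have e : 2 * (n+1) = 2*n+2 := by ring
    rw [e]
    have e' : f (2*n+2+1) = f (2*n+3) := rfl
    simp only [wAB, List.length_append]
    omega

lemma wAB_comm (k : ℕ) : ∃ (p q : List ℕ) (x y : ℕ),
    (wAB k).1 ++ (wAB k).2 = p ++ x :: y :: q ∧ (wAB k).2 ++ (wAB k).1 = p ++ y :: x :: q ∧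
    p.length = q.length ∧ (x : ℤ) - y = (-1)^k := by
  induction k with
  | zero => exact ⟨[], [], 1, 0, by simp [wAB], by simp [wAB], rfl, by simp⟩
  | succ k ih =>
    obtain ⟨p, q, x, y, h1, h2, h3, h4⟩ := ih
    refine ⟨(wAB k).1 ++ p, q ++ (wAB k).1, y, x, ?_, ?_, ?_, ?_⟩
    · calc _ = (wAB k).1 ++ ((wAB k).2 ++ (wAB k).1) ++ (wAB k).1 := by simp [wAB]
        _ = _ := by rw [h2]; simp
    · calc _ = (wAB k).1 ++ ((wAB k).1 ++ (wAB k).2) ++ (wAB k).1 := by simp [wAB]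
        _ = _ := by rw [h1]; simp
    · simp [h3]; omega
    · rw [pow_succ, ← h4]; ring

/-- The two factors of τ^{k+1}(1) giving two almost equal rows. -/
lemma wAB_factors (k : ℕ) : ∃ (c P1 R1 P2 R2 : List ℕ) (x y : ℕ),
    (wAB (k+1)).1 = P1 ++ (y :: c ++ [x]) ++ R1 ∧ (wAB (k+1)).1 = P2 ++ (x :: c ++ [y]) ++ R2 ∧
    c.length + 2 = (wAB k).1.length + (wAB k).2.length ∧
    2 * P1.length = c.length + 2 ∧ P2.length + P1.length = (wAB k).1.length ∧
    (x : ℤ) - y = (-1)^k := by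
  obtain ⟨p, q, x, y, h1, h2, h3, h4⟩ := wAB_comm k
  have hlen : (wAB k).2.length ≤ (wAB k).1.length := by
    cases k with
    | zero => simp [wAB]
    | succ k => simp [wAB]
  have hl1 := congrArg List.length h1
  simp only [List.length_append, List.length_cons] at hl1
  -- prefix
  obtain ⟨r, hr⟩ : p ++ [x] <+: (wAB k).1 := by
    refine List.prefix_of_prefix_length_le (l₃ := (wAB k).1 ++ (wAB k).2) ?_ ?_ ?_
    · exact ⟨y :: q, by rw [h1]; simp⟩
    · exact List.prefix_append _ _
    · simp; omega
  obtain ⟨t, ht⟩ : x :: q <:+ (wAB k).1 := by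
    refine List.suffix_of_suffix_length_le (l₃ := (wAB k).2 ++ (wAB k).1) ?_ ?_ ?_
    · exact ⟨p ++ [y], by rw [h2]; simp⟩
    · exact List.suffix_append _ _
    · simp; omega
  refine ⟨q ++ p, p ++ [x], r, t, x :: q, x, y, ?_, ?_, ?_, ?_, ?_, h4⟩
  · calc _ = ((wAB k).1 ++ (wAB k).2) ++ (wAB k).1 := rfl
      _ = (p ++ x :: y :: q) ++ (p ++ [x] ++ r) := by rw [h1, hr]
      _ = _ := by simp
  · calc _ = (wAB k).1 ++ ((wAB k).2 ++ (wAB k).1) := by simp [wAB]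
      _ = (t ++ x :: q) ++ (p ++ y :: x :: q) := by rw [h2, ht]
      _ = _ := by simp
  · simp; omega
  · simp; omega
  · have := congrArg List.length ht
    simp at this ⊢; omega

lemma occ (f : ℕ → ℕ) (hf : IsFSeq f) (c : ℕ) (b : ℕ → ℕ) (hb : ∀ i, b i ≤ 1)
    (hb1 : ∀ i, b i * b (i+1) = 0) (hb2 : ∀ i, Even i → b i * b (i+2) = 0)
    (h0 : ∀ i, i < 2*c+1 → b i = 0) (d : ℕ) :
    (∃ u v, (wAB (c+d)).1 = u ++ (wAB c).1 ++ v ∧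
      u.length = ∑ i ∈ Finset.range (2*(c+d)), b i * f i) ∧
    (∃ u v, (wAB (c+d+1)).1 = u ++ (wAB c).1 ++ v ∧
      u.length = ∑ i ∈ Finset.range (2*(c+d+1)), b i * f i) := by
  have zs : ∀ N, N ≤ 2*c+1 → ∑ i ∈ Finset.range N, b i * f i = 0 := by
    intro N hN
    apply Finset.sum_eq_zero
    intro i hi
    rw [Finset.mem_range] at hi
    rw [h0 i (by omega), zero_mul]
  -- common step for the cases where the digit `2K` vanishes
  have step : ∀ K, b (2*K) = 0 →
      (∃ u v, (wAB K).1 = u ++ (wAB c).1 ++ v ∧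
        u.length = ∑ i ∈ Finset.range (2*K), b i * f i) →
      (∃ u v, (wAB (K+1)).1 = u ++ (wAB c).1 ++ v ∧
        u.length = ∑ i ∈ Finset.range (2*(K+1)), b i * f i) := by
    rintro K hK ⟨u, v, huv, hu⟩
    have e : 2*(K+1) = 2*K+1+1 := by ring
    rw [e, Finset.sum_range_succ, Finset.sum_range_succ, hK, ← hu]
    have hlen := wAB_len f hf K
    have := hb (2*K+1)
    rcases Nat.lt_or_ge (b (2*K+1)) 1 with h | h
    · have h' : b (2*K+1) = 0 := by omega
      rw [h']
      refine ⟨u, v ++ (wAB K).2 ++ (wAB K).1, ?_, by simp⟩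
      calc _ = (wAB K).1 ++ ((wAB K).2 ++ (wAB K).1) := by simp [wAB]
        _ = (u ++ (wAB c).1 ++ v) ++ ((wAB K).2 ++ (wAB K).1) := by rw [← huv]
        _ = _ := by simp
    · have h' : b (2*K+1) = 1 := by omega
      rw [h']
      refine ⟨(wAB K).1 ++ (wAB K).2 ++ u, v, ?_, by simp; omega⟩
      calc _ = (wAB K).1 ++ (wAB K).2 ++ (wAB K).1 := rfl
        _ = (wAB K).1 ++ (wAB K).2 ++ (u ++ (wAB c).1 ++ v) := by rw [← huv]
        _ = _ := by simp
  induction d with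
  | zero =>
    have base : ∃ u v, (wAB (c+0)).1 = u ++ (wAB c).1 ++ v ∧
      u.length = ∑ i ∈ Finset.range (2*(c+0)), b i * f i :=
        ⟨[], [], by simp, by rw [zs _ (by omega)]; rfl⟩
    exact ⟨base, step c (h0 _ (by omega)) base⟩
  | succ d ih =>
    obtain ⟨ih1, ih2⟩ := ih
    refine ⟨ih2, ?_⟩
    have hb' := hb (2*(c+d+1))
    rcases Nat.lt_or_ge (b (2*(c+d+1))) 1 with h | h
    · exact step (c+d+1) (by omega) ih2
    · have h' : b (2*(c+d+1)) = 1 := by omega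
      obtain ⟨u, v, huv, hu⟩ := ih1
      have q1 := hb1 (2*(c+d+1))
      have q2 := hb1 (2*(c+d)+1)
      have q3 := hb2 (2*(c+d)) (by simp)
      have e1 : 2*(c+d)+1+1 = 2*(c+d+1) := by ring
      have e2 : 2*(c+d)+2 = 2*(c+d+1) := by ring
      rw [e1, h', mul_one] at q2
      rw [e2, h', mul_one] at q3
      rw [h', one_mul] at q1
      have e : 2*(c+(d+1)+1) = 2*(c+d+1)+1+1 := by ring
      have e4 : ∑ i ∈ Finset.range (2*(c+d+1)), b i * f i =
          ∑ i ∈ Finset.range (2*(c+d)), b i * f i := by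
        rw [← e1, Finset.sum_range_succ, Finset.sum_range_succ, q2, q3]; simp
      rw [e, Finset.sum_range_succ, Finset.sum_range_succ, q1, h', e4, ← hu]
      have hlen := wAB_len f hf (c+d+1)
      refine ⟨(wAB (c+d+1)).1 ++ u, v ++ (wAB (c+d+1)).1, ?_, by simp; omega⟩
      calc _ = (wAB (c+d+1)).1 ++ (wAB (c+d)).1 ++ (wAB (c+d+1)).1 := rfl
        _ = (wAB (c+d+1)).1 ++ (u ++ (wAB c).1 ++ v) ++ (wAB (c+d+1)).1 := by rw [← huv]
        _ = _ := by simp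

lemma f_mono (f : ℕ → ℕ) (hf : IsFSeq f) : Monotone f := by
  apply monotone_nat_of_le_succ
  intro n
  have key : ∀ m, f (2*m) ≤ f (2*m+1) := by
    intro m
    have := wAB_len f hf m
    omega
  rcases Nat.even_or_odd' n with ⟨m, rfl | rfl⟩
  · exact key m
  · have := hf.2.2.1 m
    show f (2*m+1) ≤ f (2*m+2)
    omega

lemma det_rows (s : ℕ → ℕ) (m N β : ℕ) (d : ℤ) (hN : Odd N) (hβ : β < N)
    (h0 : (s (m + N) : ℤ) - s (m + β) = -d)
    (hl : (s (m + N + N) : ℤ) - s (m + β + N) = d)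
    (hm : ∀ j, 0 < j → j < N → s (m + N + j) = s (m + β + j)) :
    H s m (N+1) = d * (H s (m+1) N + H s m N) := by
  set M : Matrix (Fin (N+1)) (Fin (N+1)) ℤ := Matrix.of fun i j => (s (m + i.1 + j.1) : ℤ) with hM
  have hNpos : 0 < N := by omega
  have hne : Fin.last N ≠ (⟨β, by omega⟩ : Fin (N+1)) := by
    intro h; have := congrArg Fin.val h; simp at this; omega
  have e1 := Matrix.det_updateRow_add_smul_self M hne (-1)
  have e2 : M (Fin.last N) + (-1 : ℤ) • M ⟨β, by omega⟩ =
      d • (Pi.single (Fin.last N) 1 : Fin (N+1) → ℤ) + (-d) • (Pi.single 0 1 : Fin (N+1) → ℤ) := by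
    funext j
    have hj := j.2
    by_cases hj0 : j.1 = 0
    · have : j = 0 := Fin.ext hj0
      subst this
      have : (0 : Fin (N+1)) ≠ Fin.last N := by
        intro h; have := congrArg Fin.val h; simp at this; omega
      simp [hM, this]
      linarith
    · by_cases hjN : j.1 = N
      · have : j = Fin.last N := Fin.ext hjN
        subst this
        have : Fin.last N ≠ 0 := by
          intro h; exact hj0 (congrArg Fin.val h)
        simp [hM, this]
        linarith
      · have a1 : j ≠ 0 := fun h => hj0 (by rw [h]; rfl)
        have a2 : j ≠ Fin.last N := fun h => hjN (by rw [h]; rfl)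
        have := hm j.1 (by omega) (by omega)
        simp [hM, a1, a2, this]
  rw [e2, Matrix.det_updateRow_add, Matrix.det_updateRow_smul, Matrix.det_updateRow_smul,
    ← Matrix.adjugate_apply, ← Matrix.adjugate_apply,
    Matrix.adjugate_fin_succ_eq_det_submatrix, Matrix.adjugate_fin_succ_eq_det_submatrix] at e1
  have b1 : (M.submatrix (Fin.last N).succAbove (Fin.last N).succAbove).det = H s m N := by
    unfold H; congr 1; ext i j; simp [hM]
  have b2 : (M.submatrix (Fin.last N).succAbove (Fin.succAbove 0)).det = H s (m+1) N := by
    unfold H; congr 1; ext i j; simp [hM]; congr 1; ring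
  rw [b1, b2] at e1
  have : H s m (N+1) = M.det := rfl
  rw [this, ← e1]
  have p1 : (-1 : ℤ)^(N+N) = 1 := Even.neg_one_pow ⟨N, rfl⟩
  have p2 : (-1 : ℤ)^N = -1 := hN.neg_one_pow
  simp [p1, p2]
  ring

lemma main_aux (s : ℕ → ℕ) (k y : ℕ)
    (hy : ∀ j, j < (wAB (k+1)).1.length → s (y + j) = ((wAB (k+1)).1).getD j 0)
    (h : ℕ) (hk : (wAB k).1.length + (wAB k).2.length = 2 * h) (hyh : h ≤ y + 1) :
    H s (y + 1 - h) (2*h) = (-1 : ℤ)^k * (H s (y + 2 - h) (2*h-1) + H s (y+1-h) (2*h-1)) := by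
  obtain ⟨c, P1, R1, P2, R2, x, z, g1, g2, g3, g4, g5, g6⟩ := wAB_factors k
  have get : ∀ (P R C : List ℕ) (u v : ℕ), (wAB (k+1)).1 = P ++ (u :: C ++ [v]) ++ R →
      s (y + P.length) = u ∧ s (y + P.length + (C.length + 1)) = v ∧
      ∀ j, j < C.length → s (y + P.length + (j+1)) = C.getD j 0 := by
    intro P R C u v hw
    rw [hw] at hy
    refine ⟨?_, ?_, ?_⟩
    · rw [hy _ (by simp; try omega)]
      simp [List.getD_eq_getElem?_getD]
    · rw [add_assoc, hy _ (by simp; try omega)]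
      simp [List.getD_eq_getElem?_getD, List.getElem?_append]
    · intro j hj
      rw [add_assoc, hy _ (by simp; try omega)]
      simp [List.getD_eq_getElem?_getD, List.getElem?_append, hj]
  obtain ⟨r1, r2, r3⟩ := get P1 R1 c z x g1
  obtain ⟨t1, t2, t3⟩ := get P2 R2 c x z g2
  have hP1 : P1.length = h := by omega
  have hlen2 : (wAB k).1.length - 1 < 2*h-1 := by
    have : 0 < (wAB k).2.length := by
      cases k with
      | zero => simp [wAB]
      | succ k =>
        have : ∀ n, 0 < (wAB n).1.length := by
          intro n
          induction n with
          | zero => simp [wAB]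
          | succ n ih => simp only [wAB, List.length_append]; omega
        exact this k
    omega
  have hpos : 1 ≤ h := by omega
  have key := det_rows s (y+1-h) (2*h-1) ((wAB k).1.length - 1) ((-1)^k)
    ⟨h-1, by omega⟩ hlen2 ?_ ?_ ?_
  · have e1 : 2*h-1+1 = 2*h := by omega
    have e2 : y+1-h+1 = y+2-h := by omega
    rw [e1, e2] at key
    exact key
  · have e1 : y + 1 - h + (2*h-1) = y + P1.length := by omega
    have e2 : y + 1 - h + ((wAB k).1.length - 1) = y + P2.length := by omega
    rw [e1, e2, r1, t1, ← g6]; ring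
  · have e1 : y + 1 - h + (2*h-1) + (2*h-1) = y + P1.length + (c.length+1) := by omega
    have e2 : y + 1 - h + ((wAB k).1.length - 1) + (2*h-1) = y + P2.length + (c.length+1) := by omega
    rw [e1, e2, r2, t2, ← g6]
  · intro j hj0 hj
    obtain ⟨i, rfl⟩ : ∃ i, j = i + 1 := ⟨j-1, by omega⟩
    have e1 : y + 1 - h + (2*h-1) + (i+1) = y + P1.length + (i+1) := by omega
    have e2 : y + 1 - h + ((wAB k).1.length - 1) + (i+1) = y + P2.length + (i+1) := by omega
    rw [e1, e2, r3 i (by omega), t3 i (by omega)]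

theorem lower_left_corner_T (f : ℕ → ℕ) (hf : IsFSeq f) (s : ℕ → ℕ) (hs : IsFixedSeq s) (a : ℕ → ℕ → ℕ) (ha : ∀ n, IsFRep f n (a n)) :
    ∀ k γ : ℕ, 1 ≤ k →
      Phi f a k γ = f (2*k+3) / 2 → f (2*k+3) / 2 < γ →
      H s (γ + 1 - f (2*k+2)) (f (2*k+1)) =
        (-1 : ℤ)^k * (H s (γ + 2 - f (2*k+2)) (f (2*k+1) - 1) +
          H s (γ + 1 - f (2*k+2)) (f (2*k+1) - 1)) := by
  intro k γ hk hPhi hγ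
  obtain ⟨c1, c2, c3, N, hN, hsum⟩ := ha γ
  have hlen := wAB_len f hf k
  obtain ⟨h, hh⟩ : ∃ h, f (2*k+1) = 2*h := by
    obtain ⟨c, P1, R1, P2, R2, x, z, g1, g2, g3, g4, g5, g6⟩ := wAB_factors k
    exact ⟨P1.length, by omega⟩
  have f2 := hf.2.2.1 k
  have f3 := hf.2.2.2 k
  have hhalf : f (2*k+3) / 2 = f (2*k) + h := by omega
  -- the truncated digits
  set b : ℕ → ℕ := fun i => if i < 2*k+3 then 0 else a γ i with hb
  set D := N with hD
  have hbig : γ = ∑ i ∈ Finset.range (2*(k+1+D)+1), a γ i * f i := by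
    refine hsum.trans ?_
    apply Finset.sum_subset
    · intro i hi; rw [Finset.mem_range] at *; omega
    · intro i _ hi
      rw [Finset.mem_range] at hi
      rw [hN i (by omega), zero_mul]
  have hlast : b (2*(k+1+D)) = 0 := by
    simp only [hb]
    split_ifs
    · rfl
    · exact hN _ (by omega)
  have hsplit : γ = Phi f a k γ + ∑ i ∈ Finset.range (2*(k+1+D)), b i * f i := by
    have e1 : ∑ i ∈ Finset.range (2*(k+1+D)), b i * f i =
        ∑ i ∈ Finset.range (2*(k+1+D)+1), b i * f i := by
      rw [Finset.sum_range_succ, hlast]; simp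
    have e2 : Phi f a k γ = ∑ i ∈ Finset.range (2*(k+1+D)+1), (if i < 2*k+3 then a γ i * f i else 0) := by
      unfold Phi
      rw [← Finset.sum_filter]
      apply Finset.sum_congr _ (fun _ _ => rfl)
      ext i; simp; omega
    rw [e1, e2, ← Finset.sum_add_distrib]
    conv_lhs => rw [hbig]
    apply Finset.sum_congr rfl
    intro i _
    simp only [hb]
    split_ifs <;> simp
  set y := ∑ i ∈ Finset.range (2*(k+1+D)), b i * f i with hy
  have hypos : 0 < y := by omega
  have hyh : h ≤ y := by
    obtain ⟨i, hi, hne⟩ := Finset.exists_ne_zero_of_sum_ne_zero (show y ≠ 0 by omega)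
    have hle : b i * f i ≤ y := Finset.single_le_sum (f := fun i => b i * f i) (fun _ _ => Nat.zero_le _) hi
    have hbi : b i ≠ 0 := fun hz => hne (by simp [hz])
    have hik : 2*k+3 ≤ i := by
      by_contra hlt
      apply hbi
      simp only [hb]
      rw [if_pos (by omega)]
    have hm := f_mono f hf hik
    have : f i ≤ b i * f i := Nat.le_mul_of_pos_left _ (by omega)
    omega
  obtain ⟨⟨u, v, huv, hu⟩, -⟩ := occ f hf (k+1) b
    (fun i => by simp only [hb]; split_ifs; · omega
                 · exact c1 i)
    (fun i => by simp only [hb]; split_ifs <;> simp [c2 i])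
    (fun i hi => by simp only [hb]; split_ifs <;> simp [c3 i hi])
    (fun i hi => by simp only [hb]; rw [if_pos (by omega)]) D
  have hfac : ∀ j, j < (wAB (k+1)).1.length → s (y + j) = ((wAB (k+1)).1).getD j 0 := by
    intro j hj
    have := hs (k+1+D) (y+j) (by rw [tauIter_eq, huv]; simp; omega)
    rw [this, tauIter_eq, huv, hy, ← hu]
    simp [List.getD_eq_getElem?_getD, List.getElem?_append, hj]
  have key := main_aux s k y hfac h (by omega) (by omega)
  have e1 : γ + 1 - f (2*k+2) = y + 1 - h := by omega
  have e2 : γ + 2 - f (2*k+2) = y + 2 - h := by omega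
  rw [e1, e2, hh]
  exact key
end

section
/- For every integer k ≥ 1, the Hankel determinant H_{f_{2k+1}/2 + f_{2k+3} + 1, f_{2k}} equals (−1)^{k + (f_{2k+2}+1)/2} · f_{2k+1}/2. (Note that f_{2k+2} is odd, so (f_{2k+2}+1)/2 is an integer.) -/
/-- The Hankel-type matrix with first column all ones. -/
def Dm (v : ℕ → ℤ) (n : ℕ) : Matrix (Fin n) (Fin n) ℤ :=
  Matrix.of fun i j => if j.1 = 0 then 1 else v (i.1 + (j.1 - 1))

/-- Antitriangular block. -/
def Em (ε : ℤ) (d : ℕ) : Matrix (Fin d) (Fin d) ℤ :=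
  Matrix.of fun i j => ε * ((if i.1 + j.1 + 1 = d then 1 else 0) - (if i.1 + j.1 = d then 1 else 0))

lemma Em_succ (ε : ℤ) (d : ℕ) : (Em ε (d+1)).det = (-1)^d * ε * (Em ε d).det := by
  rw [Matrix.det_succ_row_zero, Finset.sum_eq_single (Fin.last d)]
  · have h1 : Em ε (d+1) 0 (Fin.last d) = ε := by simp [Em]
    have h2 : (Em ε (d+1)).submatrix Fin.succ (Fin.last d).succAbove = Em ε d := by
      ext i j
      simp only [Em, Matrix.submatrix_apply, Matrix.of_apply, Fin.val_succ, Fin.succAbove_last,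
        Fin.val_castSucc]
      congr 2
      · congr 1; apply propext; omega
      · congr 1; apply propext; omega
    rw [h1, h2]; simp
  · intro j _ hj
    have : j.1 ≠ d := fun h => hj (Fin.ext h)
    have h1 : Em ε (d+1) 0 j = 0 := by
      have := j.2
      have h0 : (0 : Fin (d+1)).1 = 0 := rfl
      simp only [Em, Matrix.of_apply]
      rw [if_neg (by omega), if_neg (by omega)]; simp
    rw [h1]; simp
  · simp

lemma Em_det (ε : ℤ) (hε : ε * ε = 1) (e : ℕ) : (Em ε (2*e)).det = (-1)^e := by
  induction e with
  | zero => simp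
  | succ e ih =>
    rw [show 2*(e+1) = 2*e+1+1 by ring, Em_succ, Em_succ, ih]
    have : (-1:ℤ)^(2*e) = 1 := by simp [pow_mul]
    rw [pow_succ (-1:ℤ) (2*e), pow_succ (-1:ℤ) e, this]
    linear_combination (-(-1:ℤ)^e) * hε

/-- unitriangular row operation -/
def Lm (a n : ℕ) : Matrix (Fin n) (Fin n) ℤ :=
  Matrix.of fun i j => if i = j then 1 else if i.1 = j.1 + a then -1 else 0

lemma Lm_det (a n : ℕ) : (Lm a n).det = 1 := by
  rw [Matrix.det_of_isLowerTriangular]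
  · simp [Lm]
  · intro i j hij
    have : i.1 < j.1 := hij
    simp only [Lm, Matrix.of_apply]
    rw [if_neg (by intro h; subst h; omega), if_neg (by omega)]

lemma Lm_mul_lt (a n : ℕ) (A : Matrix (Fin n) (Fin n) ℤ) (i j : Fin n) (hi : i.1 < a) :
    (Lm a n * A) i j = A i j := by
  rw [Matrix.mul_apply, Finset.sum_eq_single i]
  · simp [Lm]
  · intro b _ hb
    simp only [Lm, Matrix.of_apply]
    rw [if_neg (Ne.symm hb), if_neg (by omega)]; simp
  · simp

lemma Lm_mul_ge (a n : ℕ) (ha : 1 ≤ a) (A : Matrix (Fin n) (Fin n) ℤ) (i i' j : Fin n)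
    (hi : i.1 = i'.1 + a) :
    (Lm a n * A) i j = A i j - A i' j := by
  have hne : i ≠ i' := by intro h; subst h; omega
  have : ∀ b : Fin n, Lm a n i b * A b j =
      (if b = i then A i j else 0) + (if b = i' then - A i' j else 0) := by
    intro b
    simp only [Lm, Matrix.of_apply]
    by_cases h1 : i = b
    · subst h1; simp [hne]
    · rw [if_neg h1, if_neg (Ne.symm h1)]
      by_cases h2 : b = i'
      · subst h2; simp [hi]
      · rw [if_neg h2, if_neg]; · simp
        intro h3; apply h2; apply Fin.ext; omega
  rw [Matrix.mul_apply, Finset.sum_congr rfl (fun b _ => this b), Finset.sum_add_distrib]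
  simp [sub_eq_add_neg]

lemma Dm_step (v : ℕ → ℤ) (a e : ℕ) (ha : 1 ≤ a) (ε : ℤ) (hε : ε * ε = 1)
    (hv : ∀ r, r + a + 3 ≤ 2 * (a + 2 * e) → v (r + a) - v r =
      ε * ((if r + 2 = a + 2*e then 1 else 0) - (if r + 1 = a + 2*e then 1 else 0))) :
    (Dm v (a + 2*e)).det = (-1)^e * (Dm v a).det := by
  have h1 : (Dm v (a + 2*e)).det = (Lm a (a+2*e) * Dm v (a+2*e)).det := by
    rw [Matrix.det_mul, Lm_det, one_mul]
  rw [h1, ← Matrix.det_submatrix_equiv_self finSumFinEquiv]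
  have h2 : (Lm a (a+2*e) * Dm v (a+2*e)).submatrix finSumFinEquiv finSumFinEquiv =
      Matrix.fromBlocks (Dm v a)
        (Matrix.of fun i j => Dm v (a+2*e) (Fin.castAdd _ i) (Fin.natAdd _ j)) 0 (Em ε (2*e)) := by
    ext i j
    have key : ∀ (i : Fin (2*e)) (j : Fin (a + 2*e)), (Lm a (a+2*e) * Dm v (a+2*e)) (Fin.natAdd a i) j
        = if j.1 = 0 then 0 else ε * ((if i.1 + j.1 + 1 = a + 2*e then 1 else 0)
          - (if i.1 + j.1 = a + 2*e then 1 else 0)) := by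
      intro i j
      have hi := i.2
      have hj := j.2
      rw [Lm_mul_ge a _ ha _ _ ⟨i.1, by omega⟩ _ (by simp; omega)]
      simp only [Dm, Matrix.of_apply, Fin.val_natAdd]
      by_cases h : j.1 = 0
      · simp [h]
      · rw [if_neg h, if_neg h, if_neg h,
          show a + i.1 + (j.1 - 1) = i.1 + (j.1-1) + a by omega, hv _ (by omega)]
        simp only [show (i.1 + (j.1-1) + 2 = a + 2*e) ↔ i.1 + j.1 + 1 = a + 2*e by omega,
          show (i.1 + (j.1-1) + 1 = a + 2*e) ↔ i.1 + j.1 = a + 2*e by omega]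
    rcases i with i | i <;> rcases j with j | j
    · simp only [Matrix.submatrix_apply, finSumFinEquiv_apply_left, Matrix.fromBlocks_apply₁₁]
      rw [Lm_mul_lt _ _ _ _ _ (by simp)]
      simp [Dm]
    · simp only [Matrix.submatrix_apply, finSumFinEquiv_apply_left, finSumFinEquiv_apply_right,
        Matrix.fromBlocks_apply₁₂]
      rw [Lm_mul_lt _ _ _ _ _ (by simp)]
      simp
    · simp only [Matrix.submatrix_apply, finSumFinEquiv_apply_left, finSumFinEquiv_apply_right,
        Matrix.fromBlocks_apply₂₁]
      have hi := i.2
      have hj := j.2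
      rw [key]
      simp only [Fin.val_castAdd]
      rw [if_neg (show ¬ (i.1 + j.1 + 1 = a + 2*e) by omega), if_neg (show ¬ (i.1 + j.1 = a + 2*e) by omega)]
      simp
    · simp only [Matrix.submatrix_apply, finSumFinEquiv_apply_right,
        Matrix.fromBlocks_apply₂₂]
      rw [key]
      simp only [Fin.val_natAdd]
      rw [if_neg (by omega)]
      simp only [Em, Matrix.of_apply, show (i.1 + (a+j.1) + 1 = a + 2*e) ↔ i.1 + j.1 + 1 = 2*e by omega,
          show (i.1 + (a+j.1) = a + 2*e) ↔ i.1 + j.1 = 2*e by omega]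
  rw [h2, Matrix.det_fromBlocks_zero₂₁, Em_det ε hε, mul_comm]

lemma Dm_congr (v w : ℕ → ℤ) (n : ℕ) (h : ∀ r, r + 3 ≤ 2*n → v r = w r) : Dm v n = Dm w n := by
  ext i j
  simp only [Dm, Matrix.of_apply]
  split_ifs with hj
  · rfl
  · apply h; omega

lemma hankel_to_Dm (v : ℕ → ℤ) (n : ℕ) (hn : Odd n) (P : ℤ)
    (hP : ∑ j ∈ Finset.range n, v j = P) (hper : ∀ r, r < n → v (r + n) = v r) :
    (Matrix.of fun i j : Fin n => v (i.1 + j.1)).det = P * (Dm v n).det := by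
  obtain ⟨q, rfl⟩ := hn
  have hS : ∀ i, i ≤ 2*q+1 → ∑ j ∈ Finset.range (2*q+1), v (i + j) = P := by
    intro i
    induction i with
    | zero => intro _; simpa using hP
    | succ i ih =>
      intro hi
      rw [← ih (by omega), ← sub_eq_zero]
      have h1 := Finset.sum_range_succ (fun j => v (i + j)) (2*q+1)
      have h2 := Finset.sum_range_succ' (fun j => v (i + j)) (2*q+1)
      have h3 := hper i (by omega)
      simp only [add_zero] at h2
      have h4 : ∑ j ∈ Finset.range (2*q+1), v (i + 1 + j) = ∑ j ∈ Finset.range (2*q+1), v (i + (j + 1)) :=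
        Finset.sum_congr rfl (fun j _ => by congr 1; ring)
      rw [h4]; linarith
  set M : Matrix (Fin (2*q+1)) (Fin (2*q+1)) ℤ := Matrix.of fun i j => v (i.1 + j.1) with hM
  have h1 := Matrix.det_updateCol_sum M (Fin.last _) (fun _ => 1)
  have h2 : (fun k => ∑ i, (1:ℤ) • M k i) = P • (fun _ => (1:ℤ)) := by
    ext k
    have := hS k.1 (by omega)
    rw [Finset.sum_range] at this
    simpa [hM] using this
  rw [h2, Matrix.det_updateCol_smul, one_smul] at h1
  rw [← h1]
  congr 1
  have h3 : M.updateCol (Fin.last _) (fun _ => (1:ℤ)) = (Dm v (2*q+1)).submatrix id (finRotate _) := by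
    ext i j
    rw [Matrix.submatrix_apply, Matrix.updateCol_apply]
    simp only [Dm, Matrix.of_apply, id]
    rw [coe_finRotate]
    split_ifs with h
    · simp
    · exact absurd rfl ‹_›
    · simp at *
    · simp [hM]
  rw [h3, Matrix.det_permute', sign_finRotate]
  simp

/-- Conjugate substitution 1 → 110, 0 → 1. -/
def tauC (b : ℕ) : List ℕ := if b = 1 then [1, 1, 0] else [1]

/-- Standard words. -/
def W : ℕ → List ℕ
  | 0 => [1]
  | 1 => [1, 1, 0]
  | (k+2) => W (k+1) ++ W (k+1) ++ W k

lemma W_flatMap (k : ℕ) : (W k).flatMap tauC = W (k+1) := by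
  induction k using W.induct with
  | case1 => rfl
  | case2 => rfl
  | case3 k ih1 ih2 =>
    rw [W, List.flatMap_append, List.flatMap_append, ih1, ih2, ← W]

lemma tau_conj (w : List ℕ) : 1 :: w.flatMap tau = w.flatMap tauC ++ [1] := by
  induction w with
  | nil => rfl
  | cons b w ih =>
    rw [List.flatMap_cons, List.flatMap_cons, List.append_assoc, ← ih]
    by_cases h : b = 1 <;> simp [tau, tauC, h]

lemma tau_length (w : List ℕ) : (w.flatMap tau).length = w.length + 2 * w.count 1 := by
  induction w with
  | nil => rfl
  | cons b w ih =>
    rw [List.flatMap_cons, List.length_append, ih]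
    by_cases h : b = 1
    · simp [tau, h]; ring
    · simp [tau, h]; ring

lemma tau_count (w : List ℕ) : (w.flatMap tau).count 1 = w.length + w.count 1 := by
  induction w with
  | nil => rfl
  | cons b w ih =>
    rw [List.flatMap_cons, List.count_append, ih]
    by_cases h : b = 1
    · simp [tau, h]; ring
    · simp [tau, h]; ring

lemma tau_last (w : List ℕ) (hw : w ≠ []) : ∃ X, w.flatMap tau = X ++ [1] := by
  obtain ⟨u, b, rfl⟩ : ∃ u b, w = u ++ [b] :=
    ⟨w.dropLast, w.getLast hw, (List.dropLast_append_getLast hw).symm⟩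
  by_cases h : b = 1
  · exact ⟨u.flatMap tau ++ [1, 0], by simp [tau, h]⟩
  · exact ⟨u.flatMap tau, by simp [tau, h]⟩

lemma W_length (f : ℕ → ℕ) (hf : IsFSeq f) (k : ℕ) : (W k).length = f (2*k) := by
  obtain ⟨h0, h1, he, ho⟩ := hf
  induction k using W.induct with
  | case1 => simp [W, h0]
  | case2 =>
    have := he 0
    simp [W, h0, h1] at *; omega
  | case3 k ih1 ih2 =>
    have a1 := he (k+1)
    have a2 := ho k
    rw [show 2*(k+1)+1 = 2*k+3 by ring] at a1
    rw [show 2*(k+1) = 2*k+2 by ring] at *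
    rw [show 2*(k+2) = 2*k+2+2 by ring, a1, a2]
    simp only [W, List.length_append]; omega

lemma W_sum (f : ℕ → ℕ) (hf : IsFSeq f) (k : ℕ) : 2 * (W k).sum = f (2*k+1) := by
  obtain ⟨h0, h1, he, ho⟩ := hf
  induction k using W.induct with
  | case1 => simp [W, h1]
  | case2 =>
    have := he 0
    have := ho 0
    simp [W, h0, h1] at *; omega
  | case3 k ih1 ih2 =>
    have a1 := he (k+1)
    have a2 := ho k
    have a3 := ho (k+1)
    have a4 := he k
    change 2 * (W (k+2)).sum = f (2*(k+2)+1)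
    simp only [W, List.sum_append]
    rw [show 2*(k+1)+3 = 2*(k+2)+1 by ring, show 2*(k+1)+2 = 2*k+4 by ring] at a3
    rw [show 2*(k+1)+2 = 2*k+4 by ring] at a1
    rw [show 2*(k+1)+1 = 2*k+3 by ring] at *
    rw [show 2*(k+1) = 2*k+2 by ring] at *
    omega

lemma f_odd (f : ℕ → ℕ) (hf : IsFSeq f) (k : ℕ) : f (2*k) % 2 = 1 := by
  have hs := W_sum f hf
  obtain ⟨h0, h1, he, ho⟩ := hf
  induction k with
  | zero => simp [h0]
  | succ k ih =>
    have := he k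
    have := hs k
    rw [show 2*(k+1) = 2*k+2 by ring]; omega

lemma occ_s17 (f : ℕ → ℕ) (hf : IsFSeq f) (k : ℕ) : ∃ N X Y, tauIter N = X ++ (W k ++ W k) ++ Y ∧
    2 * X.length = 4 * f (2*k) + 3 * f (2*k+1) + 2 ∧
    2 * X.count 1 = 3 * f (2*k) + 2 * f (2*k+1) + 1 := by
  obtain ⟨h0, h1, he, ho⟩ := hf
  induction k with
  | zero =>
    refine ⟨3, [1,0,1,1,1,0], [0,1,1,0,1,1,1,0,1], by decide, ?_, ?_⟩
    · simp [h0, h1]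
    · simp [h0, h1]
  | succ k ih =>
    obtain ⟨N, X, Y, hN, hL, hc⟩ := ih
    obtain ⟨X', hX'⟩ := tau_last X (by rintro rfl; simp at hL)
    have e1 := tau_length X
    have e2 := tau_count X
    rw [hX'] at e1 e2
    simp at e1 e2
    have a1 := he k
    have a2 := ho k
    refine ⟨N+1, X', 1 :: Y.flatMap tau, ?_, ?_, ?_⟩
    · have : tauIter (N+1) = (tauIter N).flatMap tau := rfl
      rw [this, hN, List.flatMap_append, List.flatMap_append, hX']
      have h := tau_conj (W k ++ W k)
      rw [List.flatMap_append (f := tauC), W_flatMap] at h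
      rw [List.append_assoc X', List.singleton_append, h]
      simp
    · rw [show 2*(k+1)+1 = 2*k+3 by ring, show 2*(k+1) = 2*k+2 by ring]; omega
    · rw [show 2*(k+1)+1 = 2*k+3 by ring, show 2*(k+1) = 2*k+2 by ring]; omega

/-- near commutation -/
lemma near_comm (k : ℕ) : ∃ (C : List ℕ) (x y : ℕ), W (k+1) ++ W k = C ++ [x, y] ∧ W k ++ W (k+1) = C ++ [y, x] ∧
    ((x:ℤ) - y) * ((x:ℤ) - y) = 1 := by
  induction k with
  | zero => exact ⟨[1,1], 0, 1, rfl, rfl, by norm_num⟩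
  | succ k ih =>
    obtain ⟨C, x, y, h1, h2, h3⟩ := ih
    refine ⟨W (k+1) ++ W (k+1) ++ C, y, x, ?_, ?_, by linarith⟩
    · rw [W, List.append_assoc, List.append_assoc, h2]; simp
    · rw [W, List.append_assoc (W (k+1)), h1]; simp

lemma W_prefix (k : ℕ) : ∃ Z, W (k+1) = W k ++ Z := by
  cases k with
  | zero => exact ⟨[1,0], rfl⟩
  | succ k => exact ⟨W (k+1) ++ W k, by rw [W]; simp⟩

/-- letters of the square of the standard word -/
def vv (k r : ℕ) : ℤ := ((W k ++ W k).getD r 0 : ℕ)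

lemma vv_diff (k : ℕ) : ∃ ε : ℤ, ε * ε = 1 ∧ ∀ r, r + (W (k+1)).length + 3 ≤ 2 * (W (k+2)).length →
    vv (k+2) (r + (W (k+1)).length) - vv (k+2) r =
      ε * ((if r + 2 = (W (k+2)).length then 1 else 0)
        - (if r + 1 = (W (k+2)).length then 1 else 0)) := by
  obtain ⟨C, x, y, h1, h2, h3⟩ := near_comm k
  obtain ⟨Z, hZ⟩ := W_prefix k
  refine ⟨(y:ℤ) - x, by linarith, ?_⟩
  intro r hr
  have hlen : (W (k+2)).length = (W (k+1)).length + C.length + 2 := by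
    have := congrArg List.length h1
    simp only [List.length_append, List.length_cons, List.length_nil] at this
    simp only [W, List.length_append]; omega
  have hC : (W (k+1)).length + (W k).length = C.length + 2 := by
    have := congrArg List.length h1
    simpa only [List.length_append, List.length_cons, List.length_nil] using this
  have e1 : W (k+2) ++ W (k+2) = W (k+1) ++ ((W (k+1) ++ C) ++ ([y, x] ++ (W (k+1) ++ W k))) := by
    calc _ = W (k+1) ++ (W (k+1) ++ (W k ++ W (k+1)) ++ (W (k+1) ++ W k)) := by simp [W]
      _ = _ := by rw [h2]; simp
  have e2 : W (k+2) ++ W (k+2) = (W (k+1) ++ C) ++ ([x, y] ++ (W (k+1) ++ (W k ++ Z ++ W k))) := by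
    calc _ = W (k+1) ++ (W (k+1) ++ W k) ++ (W (k+1) ++ (W (k+1) ++ W k)) := by simp [W]
      _ = W (k+1) ++ (C ++ [x,y]) ++ (W (k+1) ++ ((W k ++ Z) ++ W k)) := by rw [← hZ, ← h1]
      _ = _ := by simp
  have f1 : vv (k+2) (r + (W (k+1)).length) =
      (((W (k+1) ++ C) ++ ([y, x] ++ (W (k+1) ++ W k))).getD r 0 : ℕ) := by
    rw [vv, e1, List.getD_append_right _ _ _ _ (by omega)]; congr 2; omega
  have f2 : vv (k+2) r = 
      (((W (k+1) ++ C) ++ ([x, y] ++ (W (k+1) ++ (W k ++ Z ++ W k)))).getD r 0 : ℕ) := by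
    rw [vv, e2]
  rw [f1, f2, hlen]
  have hl : (W (k+1) ++ C).length = (W (k+1)).length + C.length := by simp
  rcases lt_or_ge r (W (k+1) ++ C).length with h | h
  · rw [List.getD_append _ _ _ _ h, List.getD_append _ _ _ _ h, if_neg (by omega), if_neg (by omega)]
    simp
  · rw [List.getD_append_right _ _ _ _ h, List.getD_append_right _ _ _ _ h]
    obtain ⟨t, rfl⟩ := Nat.exists_eq_add_of_le h
    rw [Nat.add_sub_cancel_left]
    match t with
    | 0 => rw [if_pos (by omega), if_neg (by omega)]; simp
    | 1 => rw [if_neg (by omega), if_pos (by omega)]; simp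
    | t + 2 =>
      rw [if_neg (by omega), if_neg (by omega)]
      simp only [List.cons_append, List.nil_append, List.getD_cons_succ]
      rw [List.append_assoc (W k), ← List.append_assoc (W (k+1)) (W k) (Z ++ W k),
        List.getD_append (W (k+1) ++ W k) _ _ _ (by simp only [List.length_append]; omega)]
      simp

lemma vv_prefix (k r : ℕ) (hr : r < 2 * (W (k+1)).length) : vv (k+2) r = vv (k+1) r := by
  have : W (k+2) ++ W (k+2) = (W (k+1) ++ W (k+1)) ++ (W k ++ W (k+2)) := by
    rw [W]; simp
  rw [vv, vv, this, List.getD_append _ _ _ _ (by simp only [List.length_append]; omega)]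

lemma vv_per (k r : ℕ) (hr : r < (W k).length) : vv k (r + (W k).length) = vv k r := by
  rw [vv, vv, List.getD_append_right _ _ _ _ (by omega), List.getD_append _ _ _ _ hr]
  simp

lemma sum_getD (w : List ℕ) : ∑ j ∈ Finset.range w.length, w.getD j 0 = w.sum := by
  induction w with
  | nil => rfl
  | cons b w ih =>
    rw [List.length_cons, Finset.sum_range_succ', List.sum_cons]
    simp only [List.getD_cons_succ, List.getD_cons_zero, ih]; ring

lemma vv_sum (k : ℕ) : ∑ j ∈ Finset.range (W k).length, vv k j = ((W k).sum : ℕ) := by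
  rw [← sum_getD]
  push_cast
  apply Finset.sum_congr rfl
  intro j hj
  rw [vv, List.getD_append _ _ _ _ (by simpa using hj)]

lemma D_formula (f : ℕ → ℕ) (hf : IsFSeq f) (k : ℕ) :
    (Dm (vv (k+1)) (f (2*(k+1)))).det = (-1)^((k+1) + (f (2*(k+1)+2) + 1) / 2) := by
  have hlen := W_length f hf
  have hsum := W_sum f hf
  have hodd := f_odd f hf
  obtain ⟨h0, h1, he, ho⟩ := hf
  induction k with
  | zero =>
    have b1 := he 0
    have b2 := ho 0
    have b3 := he 1
    simp only [Nat.mul_zero, Nat.mul_one, Nat.zero_add, Nat.reduceAdd, h0, h1] at b1 b2 b3 ⊢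
    rw [b3, b2, b1]
    simp [Matrix.det_fin_three, Dm, vv, W]
  | succ k ih =>
    have a1 := he (k+1)
    have a2 := ho k
    have a3 := ho (k+1)
    have a4 := he (k+2)
    have s1 := hsum (k+1)
    have o1 := hodd (k+1)
    have o2 := hodd (k+2)
    have l1 := hlen (k+1)
    have l2 := hlen (k+2)
    rw [show 2*(k+1)+3 = 2*k+5 by ring] at a3
    rw [show 2*(k+2)+2 = 2*k+6 by ring, show 2*(k+2)+1 = 2*k+5 by ring] at a4
    rw [show k+1+1 = k+2 by ring, show 2*(k+2)+2 = 2*k+6 by ring] 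
    rw [show 2*(k+1)+2 = 2*(k+2) by ring] at *
    rw [show 2*(k+1)+1 = 2*k+3 by ring] at *
    rw [show 2*k+2 = 2*(k+1) by ring] at *
    obtain ⟨ε, hε, hd⟩ := vv_diff k
    rw [l1, l2] at hd
    have hn : f (2*(k+2)) = f (2*(k+1)) + 2 * (W (k+1)).sum := by omega
    rw [hn] at hd ⊢
    rw [Dm_step _ _ _ (by omega) ε hε hd,
      Dm_congr _ (vv (k+1)) _ (fun r hr => vv_prefix k r (by omega)), ih, ← pow_add]
    have hex : k + 2 + (f (2*k+6) + 1)/2 = ((W (k+1)).sum + (k + 1 + (f (2*(k+2)) + 1)/2))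
        + 2 * ((f (2*(k+1)) + 1) / 2) := by omega
    rw [hex, pow_add _ _ (2 * _)]
    simp [pow_mul]

theorem lower_left_corner_V (f : ℕ → ℕ) (hf : IsFSeq f) (s : ℕ → ℕ) (hs : IsFixedSeq s) :
    ∀ k : ℕ, 1 ≤ k →
      H s (f (2*k+1) / 2 + f (2*k+3) + 1) (f (2*k)) =
        (-1 : ℤ)^(k + (f (2*k+2) + 1) / 2) * (f (2*k+1) / 2 : ℤ) := by
  intro k hk
  obtain ⟨k, rfl⟩ : ∃ l, k = l + 1 := ⟨k - 1, by omega⟩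
  have hD := D_formula f hf k
  have hsum := W_sum f hf (k+1)
  have hlen := W_length f hf (k+1)
  have hodd := f_odd f hf (k+1)
  obtain ⟨N, X, Y, hN, hL, -⟩ := occ_s17 f hf (k+1)
  have b1 := hf.2.2.1 (k+1)
  have b2 := hf.2.2.2 (k+1)
  have hm : f (2*(k+1)+1) / 2 + f (2*(k+1)+3) + 1 = X.length := by omega
  have hM : H s (f (2*(k+1)+1) / 2 + f (2*(k+1)+3) + 1) (f (2*(k+1))) =
      (Matrix.of fun i j : Fin (f (2*(k+1))) => vv (k+1) (i.1 + j.1)).det := by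
    rw [hm, H]
    congr 2
    ext i j
    have hi := i.2
    have hj := j.2
    rw [hs N (X.length + i.1 + j.1) (by rw [hN]; simp only [List.length_append]; omega), hN,
      List.append_assoc, List.getD_append_right _ _ _ _ (by omega),
      List.getD_append _ _ _ _ (by simp only [List.length_append]; omega), vv]
    congr 2; omega
  rw [hM, hankel_to_Dm (vv (k+1)) _ (Nat.odd_iff.mpr hodd) ((W (k+1)).sum : ℕ)
    (by rw [← hlen]; exact vv_sum _) (by rw [← hlen]; exact vv_per _), hD, mul_comm]
  congr 1
  omega
end
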